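/- Let S = {S_c : c ∈ [n]} be a collection of state trees and F a frequency tensor. An n,k-complete perfect phylogeny tree T generates F and is consistent with S if and only if T is a threaded spanning tree of the cladistic ancestry graph G_{(F,S)} such that the multi-state sum condition f⁺_p(D_{(c,i)}) − Σ_{(d,j)∈δ(c,i)} f⁺_p(D_{(d,j)}) ≥ 0 holds for all character-state pairs (c,i) and all samples p, where D_{(c,i)} = { j : i ≼_{S_c} j }. -/

import Mathlib

open Finset
open scoped Classical

/-- Vertices of an `n,k`-complete perfect phylogeny tree: `none` is the root
`v_{(*,0)}`, and `some (c, i)` with `i ≠ 0` is the vertex `v_{(c,i)}`. -/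
abbrev PPVert (n k : ℕ) [NeZero k] : Type :=
  Option (Fin n × {i : Fin k // i ≠ 0})

/-- An `n,k`-complete perfect phylogeny tree: each of the `n(k-1)` non-root
vertices `v_{(c,i)}` is the head of the unique edge labeled `(c,i)` and has a
parent vertex; a depth function witnesses acyclicity (so the parent map
generates a tree rooted at the root `none`). -/
structure CPPTree (n k : ℕ) [NeZero k] where
  parent : Fin n → {i : Fin k // i ≠ 0} → PPVert n k
  depth : PPVert n k → ℕ
  depth_lt : ∀ c i, depth (parent c i) < depth (some (c, i))

variable {m n k : ℕ} [NeZero k]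

/-- The vertex `v_{(c,i)}`; for `i = 0` this is the root `v_{(*,0)}`. -/
def vtx (c : Fin n) (i : Fin k) : PPVert n k :=
  if h : i = 0 then none else some (c, ⟨i, h⟩)

namespace CPPTree

/-- `childRel T u v` holds when `u` is the parent of `v` in `T`. -/
def childRel (T : CPPTree n k) (u v : PPVert n k) : Prop :=
  ∃ c i, v = some (c, i) ∧ T.parent c i = u

/-- The (reflexive) ancestor relation `≺_T` on the vertices of `T`. -/
def anc (T : CPPTree n k) : PPVert n k → PPVert n k → Prop :=
  Relation.ReflTransGen T.childRel

/-- The descendant set `D_{(c,i)} = { j | (c,i) ≺_T (c,j) }`. -/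
noncomputable def D (T : CPPTree n k) (c : Fin n) (i : Fin k) : Finset (Fin k) :=
  Finset.univ.filter fun j => T.anc (vtx c i) (vtx c j)

/-- The labels of the children of a vertex `v` of `T`. -/
noncomputable def childrenOf (T : CPPTree n k) (v : PPVert n k) :
    Finset (Fin n × {i : Fin k // i ≠ 0}) :=
  Finset.univ.filter fun dj => T.parent dj.1 dj.2 = v

/-- `δ(c,i)`: the labels of the children of the vertex `v_{(c,i)}`. -/
noncomputable def children (T : CPPTree n k) (c : Fin n) (i : Fin k) :
    Finset (Fin n × {i : Fin k // i ≠ 0}) :=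
  T.childrenOf (vtx c i)

end CPPTree

/-- `f` is a `k × m × n` frequency tensor. -/
def IsFreqTensor (f : Fin m → Fin n → Fin k → ℝ) : Prop :=
  (∀ p c i, 0 ≤ f p c i) ∧ ∀ p c, ∑ i, f p c i = 1

/-- The cumulative frequency `f⁺_p(D)` of `D` for character `c` in sample `p`. -/
noncomputable def fplus (f : Fin m → Fin n → Fin k → ℝ) (p : Fin m) (c : Fin n)
    (D : Finset (Fin k)) : ℝ :=
  ∑ l ∈ D, f p c l

/-- The usage `u_{p,(c,i)} = f⁺_p(D_{(c,i)}) − Σ_{(d,j)∈δ(c,i)} f⁺_p(D_{(d,j)})`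
of a vertex in sample `p`; for the root, `f⁺_p(D_{(*,0)}) = 1`. -/
noncomputable def usage (T : CPPTree n k) (f : Fin m → Fin n → Fin k → ℝ)
    (p : Fin m) : PPVert n k → ℝ
  | none => 1 - ∑ dj ∈ T.childrenOf none, fplus f p dj.1 (T.D dj.1 dj.2.1)
  | some (c, i) =>
      fplus f p c (T.D c i.1) - ∑ dj ∈ T.children c i.1, fplus f p dj.1 (T.D dj.1 dj.2.1)

/-- `v ∈ T_{(c,i)}`: the state vector of `v` has state `i` for character `c`,
i.e. `v_{(c,i)}` is the lowest ancestor of `v` among the vertices `v_{(c,j)}`. -/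
def CPPTree.hasState (T : CPPTree n k) (v : PPVert n k) (c : Fin n) (i : Fin k) : Prop :=
  T.anc (vtx c i) v ∧ ∀ j : Fin k, T.anc (vtx c j) v → T.anc (vtx c j) (vtx c i)

/-- `T_{(c,i)}`: the set of vertices whose state vector has state `i` at `c`. -/
noncomputable def CPPTree.stateSet (T : CPPTree n k) (c : Fin n) (i : Fin k) :
    Finset (PPVert n k) :=
  Finset.univ.filter fun v => T.hasState v c i


/-- `T` generates `F`: the matrix `U` defined by
`u_{p,(c,i)} = f⁺_p(D_{(c,i)}) − Σ_{(d,j)∈δ(c,i)} f⁺_p(D_{(d,j)})` is an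
`m,n,k`-usage matrix, i.e. has nonnegative entries and rows summing to 1. -/
def Generates (T : CPPTree n k) (f : Fin m → Fin n → Fin k → ℝ) : Prop :=
  (∀ (p : Fin m) (v : PPVert n k), 0 ≤ usage T f p v) ∧
    ∀ p : Fin m, ∑ v : PPVert n k, usage T f p v = 1

/-- A state tree on the states `{0,…,k−1}` of a character, rooted at state 0:
every nonzero state has a parent state, and a depth function witnesses
acyclicity. -/
structure StateTree (k : ℕ) [NeZero k] where
  parent : Fin k → Fin k
  depth : Fin k → ℕ
  depth_lt : ∀ i : Fin k, i ≠ 0 → depth (parent i) < depth i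
  parent_root : parent 0 = 0

/-- `i ≼_{S} j`: state `i` is an ancestor of state `j` in the state tree `S`
(a reflexive relation). -/
def StateTree.anc (S : StateTree k) (i j : Fin k) : Prop :=
  Relation.ReflTransGen (fun a b => b ≠ 0 ∧ S.parent b = a) i j

/-- The descendant set `D_{(c,i)} = { j | i ≼_{S_c} j }` fixed by a state
tree. -/
noncomputable def StateTree.descSet (S : StateTree k) (i : Fin k) : Finset (Fin k) :=
  Finset.univ.filter fun j => S.anc i j

/-- `T` is consistent with the collection of state trees `S`:
`(c,i) ≺_T (c,j)` if and only if `i ≼_{S_c} j`. -/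
def Consistent (T : CPPTree n k) (S : Fin n → StateTree k) : Prop :=
  ∀ (c : Fin n) (i j : Fin k), T.anc (vtx c i) (vtx c j) ↔ (S c).anc i j

/-- `(v_{(c,i)}, v_{(d,j)})` is an edge of the cladistic ancestry graph
`G_{(F,S)}`: either `c ≠ d` and `f⁺_p(D_{(c,i)}) ≥ f⁺_p(D_{(d,j)})` for all
samples `p`, or `c = d` and `i` is the parent of `j` in `S_c`. -/
def CladEdge (f : Fin m → Fin n → Fin k → ℝ) (S : Fin n → StateTree k)
    (c : Fin n) (i : Fin k) (d : Fin n) (j : Fin k) : Prop :=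
  (c ≠ d ∧ ∀ p : Fin m,
      fplus f p d ((S d).descSet j) ≤ fplus f p c ((S c).descSet i)) ∨
  (c = d ∧ j ≠ 0 ∧ (S d).parent j = i)


theorem ST_anc_depth (S : StateTree k) {i j : Fin k} (h : S.anc i j) :
    i = j ∨ S.depth i < S.depth j := by
  induction h with
  | refl => exact Or.inl rfl
  | tail _ h2 ih =>
    obtain ⟨hne, hp⟩ := h2
    have := S.depth_lt _ hne
    rw [hp] at this
    rcases ih with rfl | ih
    · exact Or.inr this
    · exact Or.inr (ih.trans this)

theorem ST_anc_antisymm (S : StateTree k) {i j : Fin k} (h : S.anc i j) (h' : S.anc j i) :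
    i = j := by
  rcases ST_anc_depth S h with h1 | h1
  · exact h1
  · rcases ST_anc_depth S h' with h2 | h2
    · exact h2.symm
    · omega

theorem ST_anc_zero (S : StateTree k) (j : Fin k) : S.anc 0 j := by
  induction hd : S.depth j using Nat.strong_induction_on generalizing j with
  | _ d ih =>
    by_cases hj : j = 0
    · subst hj; exact Relation.ReflTransGen.refl
    · exact (ih _ (hd ▸ S.depth_lt j hj) _ rfl).tail ⟨hj, rfl⟩

theorem ST_desc_iff (S : StateTree k) (i j : Fin k) :
    S.descSet j ⊆ S.descSet i ↔ S.anc i j := by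
  constructor
  · intro h
    have : j ∈ S.descSet j := by
      simp only [StateTree.descSet, Finset.mem_filter, Finset.mem_univ, true_and]
      exact Relation.ReflTransGen.refl
    simpa [StateTree.descSet] using h this
  · intro h l hl
    simp only [StateTree.descSet, Finset.mem_filter, Finset.mem_univ, true_and] at hl ⊢
    exact Relation.ReflTransGen.trans h hl

theorem ST_desc_zero (S : StateTree k) : S.descSet 0 = Finset.univ := by
  ext j
  simp [StateTree.descSet, ST_anc_zero]

theorem T_anc_some (T : CPPTree n k) {u : PPVert n k} {d : Fin n} {j : {i : Fin k // i ≠ 0}}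
    (h : T.anc u (some (d, j))) : u = some (d, j) ∨ T.anc u (T.parent d j) := by
  rcases Relation.ReflTransGen.cases_tail h with h | ⟨w, h1, c, i, he, hp⟩
  · exact Or.inl h.symm
  · simp only [Option.some.injEq, Prod.mk.injEq] at he
    obtain ⟨rfl, rfl⟩ := he
    exact Or.inr (hp ▸ h1)

theorem T_anc_none (T : CPPTree n k) {u : PPVert n k} (h : T.anc u none) : u = none := by
  rcases Relation.ReflTransGen.cases_tail h with h | ⟨w, h1, c, i, he, hp⟩
  · exact h.symm
  · cases he

theorem vtx_some (c : Fin n) (i : {i : Fin k // i ≠ 0}) : vtx c i.1 = some (c, i) := by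
  simp [vtx, i.2]

theorem vtx_zero (c : Fin n) : vtx c (0 : Fin k) = none := by
  simp [vtx]

theorem D_eq {T : CPPTree n k} {S : Fin n → StateTree k} (h : Consistent T S) (c : Fin n)
    (i : Fin k) : T.D c i = (S c).descSet i := by
  ext j
  simp [CPPTree.D, StateTree.descSet, h c i j]

theorem ST_parent_anc (S : StateTree k) {j : Fin k} (hj : j ≠ 0) : S.anc (S.parent j) j :=
  Relation.ReflTransGen.single ⟨hj, rfl⟩

theorem ST_parent_ne (S : StateTree k) {j : Fin k} (hj : j ≠ 0) : S.parent j ≠ j := by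
  intro h
  have := S.depth_lt j hj
  rw [h] at this
  omega

theorem T_parent_anc {T : CPPTree n k} {S : Fin n → StateTree k} (h : Consistent T S)
    (d : Fin n) (j : {i : Fin k // i ≠ 0}) :
    T.anc (vtx d ((S d).parent j.1)) (T.parent d j) := by
  have h1 := (h d _ _).2 (ST_parent_anc (S d) j.2)
  rw [vtx_some] at h1
  rcases T_anc_some T h1 with h2 | h2
  · exfalso
    by_cases h0 : (S d).parent j.1 = 0
    · rw [h0, vtx_zero] at h2; cases h2
    · simp only [vtx, h0, dif_neg, not_false_eq_true, Option.some.injEq, Prod.mk.injEq,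
        true_and] at h2
      exact ST_parent_ne (S d) j.2 (congrArg Subtype.val h2)
  · exact h2

theorem usage_sum (T : CPPTree n k) (f : Fin m → Fin n → Fin k → ℝ) (p : Fin m) :
    ∑ v : PPVert n k, usage T f p v = 1 := by
  have h := Finset.sum_fiberwise (Finset.univ : Finset (Fin n × {i : Fin k // i ≠ 0}))
    (fun dj => T.parent dj.1 dj.2) (fun dj => fplus f p dj.1 (T.D dj.1 dj.2.1))
  rw [Fintype.sum_option] at h ⊢
  have h2 : ∀ x : Fin n × {i : Fin k // i ≠ 0}, usage T f p (some x) =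
      fplus f p x.1 (T.D x.1 x.2.1) -
        ∑ dj ∈ T.childrenOf (some x), fplus f p dj.1 (T.D dj.1 dj.2.1) := by
    rintro ⟨c, i⟩
    simp only [usage, CPPTree.children, vtx_some]
  simp only [h2, Finset.sum_sub_distrib]
  simp only [usage, CPPTree.childrenOf]
  linarith

/-- **Proposition 2.** An `n,k`-complete perfect phylogeny tree
`T` generates `F` and is consistent with the state trees `S` if and only if
`T` is a threaded spanning tree of the cladistic ancestry graph `G_{(F,S)}`
(every tree edge is an edge of `G_{(F,S)}`, where an edge out of the root may
be regarded as leaving `v_{(c,0)}` for some character `c`, and descendant-set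
inclusion matches the ancestor relation of `T`) such that the multi-state sum
condition holds with the descendant sets `D_{(c,i)} = { j | i ≼_{S_c} j }`. -/
theorem cladistic_characterization (T : CPPTree n k) (S : Fin n → StateTree k)
    (f : Fin m → Fin n → Fin k → ℝ) (hf : IsFreqTensor f) :
    (Generates T f ∧ Consistent T S) ↔
      ((∀ (d : Fin n) (j : {j : Fin k // j ≠ 0}),
          (T.parent d j = none → ∃ c : Fin n, CladEdge f S c 0 d j.1) ∧
          ∀ (c : Fin n) (i : {i : Fin k // i ≠ 0}),
            T.parent d j = some (c, i) → CladEdge f S c i.1 d j.1) ∧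
       (∀ (c : Fin n) (i j : Fin k),
          (S c).descSet j ⊆ (S c).descSet i ↔ T.anc (vtx c i) (vtx c j)) ∧
       ∀ (p : Fin m) (c : Fin n) (i : Fin k),
         0 ≤ fplus f p c ((S c).descSet i) -
             ∑ dj ∈ T.children c i, fplus f p dj.1 ((S dj.1).descSet dj.2.1)) := by
  constructor
  · rintro ⟨⟨hpos, -⟩, hc⟩
    refine ⟨fun d j => ⟨fun hp => ⟨d, Or.inr ⟨rfl, j.2, ?_⟩⟩, fun c i hp => ?_⟩, fun c i j => ?_,
      fun p c i => ?_⟩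
    · have h := T_parent_anc hc d j
      rw [hp] at h
      have h := T_anc_none T h
      by_contra h0
      simp [vtx, h0] at h
    · by_cases hcd : c = d
      · subst hcd
        refine Or.inr ⟨rfl, j.2, ?_⟩
        have h := T_parent_anc hc c j
        rw [hp, ← vtx_some, hc] at h
        refine ST_anc_antisymm (S c) h ?_
        have h3 : T.anc (vtx c i.1) (vtx c j.1) := by
          rw [vtx_some, vtx_some]
          exact Relation.ReflTransGen.single ⟨c, j, rfl, hp⟩
        rw [hc] at h3
        rcases Relation.ReflTransGen.cases_tail h3 with h4 | ⟨w, h4, -, h5⟩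
        · exfalso
          have := T.depth_lt c j
          rw [hp, Subtype.ext h4] at this
          omega
        · rw [h5]; exact h4
      · refine Or.inl ⟨hcd, fun p => ?_⟩
        have h := hpos p (some (c, i))
        simp only [usage, D_eq hc] at h
        have h2 : (d, j) ∈ T.children c i.1 := by
          simp [CPPTree.children, CPPTree.childrenOf, vtx_some, hp]
        have h3 := Finset.single_le_sum
          (f := fun dj : Fin n × {i : Fin k // i ≠ 0} => fplus f p dj.1 ((S dj.1).descSet dj.2.1))
          (fun x _ => Finset.sum_nonneg fun l _ => hf.1 p x.1 l) h2
        simp only at h3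
        linarith
    · rw [ST_desc_iff, hc]
    · by_cases h0 : i = 0
      · subst h0
        have h := hpos p none
        simp only [usage, D_eq hc] at h
        simp only [CPPTree.children, vtx_zero, ST_desc_zero]
        simpa [fplus, hf.2] using h
      · have h := hpos p (some (c, ⟨i, h0⟩))
        simpa only [usage, D_eq hc] using h
  · rintro ⟨-, hD, hs⟩
    have hc : Consistent T S := fun c i j => by rw [← hD, ST_desc_iff]
    refine ⟨⟨fun p v => ?_, usage_sum T f⟩, hc⟩
    rcases v with _ | ⟨c, i⟩
    · simp only [usage, D_eq hc]
      rcases Nat.eq_zero_or_pos n with hn | hn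
      · subst hn
        rw [Finset.sum_eq_zero (fun x _ => x.1.elim0)]
        norm_num
      · have h := hs p ⟨0, hn⟩ 0
        simp only [CPPTree.children, vtx_zero, ST_desc_zero] at h
        have h1 : fplus f p ⟨0, hn⟩ Finset.univ = 1 := hf.2 p _
        rwa [h1] at h
    · simp only [usage, D_eq hc]
      exact hs p c i.1
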